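/- arXiv:0910.4503 — 2 statements merged into one kernel-verified Lean document; each statement's English description precedes it below -/
import Mathlib

section
/- Let X and Y be real Banach spaces and let G : X → Y be a Daugavet center with ‖G‖ = 1. Then the set A = G(B_X) (the image of the closed unit ball of X under G) is anti-dentable: for every y ∈ Y and every real number r with 0 ≤ r < sup{‖y − a‖ : a ∈ A}, the closed convex hull of A \ B̄_Y(y, r) contains A, where B̄_Y(y, r) denotes the closed ball in Y of radius r centered at y. -/
open Metric

/-- A bounded linear operator `G : X → Y` between real normed spaces is a *Daugavet center*
if `‖G + T‖ = ‖G‖ + ‖T‖` for every operator `T` of rank at most one. -/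
def IsDaugavetCenter {X Y : Type*} [NormedAddCommGroup X] [NormedSpace ℝ X]
    [NormedAddCommGroup Y] [NormedSpace ℝ Y] (G : X →L[ℝ] Y) : Prop :=
  ∀ (x' : X →L[ℝ] ℝ) (y : Y), ‖G + x'.smulRight y‖ = ‖G‖ + ‖x'.smulRight y‖

/-- Every slice of the unit ball contains points whose image under a Daugavet center of norm one
is almost as far as possible from a given nonzero point. -/
theorem IsDaugavetCenter.exists_mem_slice_of_ne_zero {X Y : Type*}
    [NormedAddCommGroup X] [NormedSpace ℝ X] [NormedAddCommGroup Y] [NormedSpace ℝ Y]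
    {G : X →L[ℝ] Y} (hG : ‖G‖ = 1) (hDC : IsDaugavetCenter G) {f : X →L[ℝ] ℝ} (hf : f ≠ 0)
    {y : Y} (hy : y ≠ 0) {ε : ℝ} (hε : 0 < ε) :
    ∃ x : X, ‖x‖ ≤ 1 ∧ ‖f‖ - ε < f x ∧ 1 + ‖y‖ - ε < ‖y - G x‖ := by
  have hN : 0 < ‖f‖ := norm_pos_iff.2 hf
  have hy0 : 0 < ‖y‖ := norm_pos_iff.2 hy
  obtain ⟨δ, hδ, hδ1, hδ2⟩ : ∃ δ : ℝ, 0 < δ ∧ 2 * δ ≤ ε ∧ ‖f‖ * δ ≤ ε * ‖y‖ := by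
    refine ⟨min (ε / 2) (ε * ‖y‖ / ‖f‖), by positivity, ?_, ?_⟩
    · linarith [min_le_left (ε / 2) (ε * ‖y‖ / ‖f‖)]
    · rw [mul_comm, ← le_div_iff₀ hN]
      exact min_le_right _ _
  have hnorm : ‖G + f.smulRight (-(‖f‖⁻¹ • y))‖ = 1 + ‖y‖ := by
    rw [hDC, hG, ContinuousLinearMap.norm_smulRight_apply, norm_neg, norm_smul, norm_inv,
      norm_norm, mul_inv_cancel_left₀ hN.ne']
  obtain ⟨x, hx, hxlt, hfx⟩ : ∃ x : X, ‖x‖ ≤ 1 ∧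
      1 + ‖y‖ - δ < ‖(G + f.smulRight (-(‖f‖⁻¹ • y))) x‖ ∧ 0 ≤ f x := by
    obtain ⟨x, hx, hxlt⟩ := ContinuousLinearMap.exists_lt_apply_of_lt_opNorm
      (G + f.smulRight (-(‖f‖⁻¹ • y))) (r := 1 + ‖y‖ - δ) (by rw [hnorm]; linarith)
    rcases le_total 0 (f x) with h | h
    · exact ⟨x, hx.le, hxlt, h⟩
    · refine ⟨-x, by rw [norm_neg]; exact hx.le, ?_, by rw [map_neg]; linarith⟩
      rwa [map_neg, norm_neg]
  obtain ⟨t, ht⟩ : ∃ t : ℝ, t = f x / ‖f‖ := ⟨_, rfl⟩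
  have hft : f x = t * ‖f‖ := by rw [ht, div_mul_cancel₀ _ hN.ne']
  have ht0 : 0 ≤ t := by rw [ht]; positivity
  have hfle : f x ≤ ‖f‖ := (le_abs_self _).trans (f.unit_le_opNorm x hx)
  have ht1 : t ≤ 1 := by rw [ht]; exact (div_le_one hN).2 hfle
  have hGx : ‖G x‖ ≤ 1 := hG ▸ G.unit_le_opNorm x hx
  have happ : (G + f.smulRight (-(‖f‖⁻¹ • y))) x = G x - t • y := by
    simp [ht, div_eq_mul_inv, smul_smul, sub_eq_add_neg]
  rw [happ] at hxlt
  have hty : ‖t • y‖ = t * ‖y‖ := by rw [norm_smul, Real.norm_of_nonneg ht0]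
  have hlow : ‖y‖ - δ < t * ‖y‖ := by linarith [norm_sub_le (G x) (t • y)]
  have hty' : ‖(1 - t) • y‖ = (1 - t) * ‖y‖ := by
    rw [norm_smul, Real.norm_of_nonneg (by linarith)]
  refine ⟨x, hx, ?_, ?_⟩
  · rw [hft]
    have h1 : ‖f‖ * ‖y‖ - ‖f‖ * δ < ‖f‖ * (t * ‖y‖) := by
      rw [← mul_sub]
      exact mul_lt_mul_of_pos_left hlow hN
    have h2 : (‖f‖ - ε) * ‖y‖ < (t * ‖f‖) * ‖y‖ := by linarith
    exact lt_of_mul_lt_mul_right h2 hy0.le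
  · have hdec : G x - t • y = (1 - t) • y - (y - G x) := by
      rw [sub_smul, one_smul]; abel
    have := norm_sub_le ((1 - t) • y) (y - G x)
    rw [← hdec] at this
    linarith

/-- Every slice of the unit ball contains points whose image under a Daugavet center of norm one
is almost as far as possible from a given point. -/
theorem IsDaugavetCenter.exists_mem_slice {X Y : Type*}
    [NormedAddCommGroup X] [NormedSpace ℝ X] [NormedAddCommGroup Y] [NormedSpace ℝ Y]
    {G : X →L[ℝ] Y} (hG : ‖G‖ = 1) (hDC : IsDaugavetCenter G) {f : X →L[ℝ] ℝ} (hf : f ≠ 0)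
    (y : Y) {ε : ℝ} (hε : 0 < ε) :
    ∃ x : X, ‖x‖ ≤ 1 ∧ ‖f‖ - ε < f x ∧ 1 + ‖y‖ - ε < ‖y - G x‖ := by
  rcases ne_or_eq y 0 with hy | rfl
  · exact hDC.exists_mem_slice_of_ne_zero hG hf hy hε
  obtain ⟨v, hv⟩ : ∃ v, G v ≠ 0 := by
    by_contra! h
    have : G = 0 := ContinuousLinearMap.ext h
    simp [this] at hG
  obtain ⟨x, hx, hfx, hGx⟩ := hDC.exists_mem_slice_of_ne_zero hG hf hv hε
  refine ⟨x, hx, hfx, ?_⟩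
  rw [zero_sub, norm_neg, norm_zero]
  linarith [norm_sub_le (G v) (G x)]

/-- If `G` is a Daugavet center of norm one, then `A = G(B_X)` is anti-dentable. -/
theorem stmt6 {X Y : Type*} [NormedAddCommGroup X] [NormedSpace ℝ X] [CompleteSpace X]
    [NormedAddCommGroup Y] [NormedSpace ℝ Y] [CompleteSpace Y]
    (G : X →L[ℝ] Y) (hG : ‖G‖ = 1) (hDC : IsDaugavetCenter G) :
    ∀ (y : Y) (r : ℝ), 0 ≤ r →
      r < sSup {d : ℝ | ∃ a ∈ G '' closedBall (0 : X) 1, d = ‖y - a‖} →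
      G '' closedBall (0 : X) 1 ⊆
        closure (convexHull ℝ ((G '' closedBall (0 : X) 1) \ closedBall y r)) := by
  intro y r _ hr a ha
  by_contra hna
  obtain ⟨f, u, hfu, hua⟩ := geometric_hahn_banach_closed_point
    (convex_convexHull ℝ ((G '' closedBall (0 : X) 1) \ closedBall y r)).closure
    isClosed_closure hna
  obtain ⟨x₀, hx₀, rfl⟩ := ha
  have hx₀' : ‖x₀‖ ≤ 1 := by simpa using hx₀
  suffices ∃ x : X, ‖x‖ ≤ 1 ∧ u < f (G x) ∧ r < ‖y - G x‖ by
    obtain ⟨x, hx, hux, hrx⟩ := this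
    refine lt_asymm hux (hfu _ (subset_closure (subset_convexHull ℝ _ ⟨⟨x, by simpa, rfl⟩, ?_⟩)))
    rw [mem_closedBall, dist_comm, dist_eq_norm]
    exact not_le.2 hrx
  have hne : {d : ℝ | ∃ a ∈ G '' closedBall (0 : X) 1, d = ‖y - a‖}.Nonempty :=
    ⟨_, G x₀, ⟨x₀, hx₀, rfl⟩, rfl⟩
  obtain ⟨_, ⟨_, ⟨z, hz, rfl⟩, rfl⟩, hrz⟩ := exists_lt_of_lt_csSup hne hr
  have hz' : ‖z‖ ≤ 1 := by simpa using hz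
  rcases eq_or_ne (f.comp G) 0 with hf | hf
  · have hf' (x : X) : f (G x) = 0 := DFunLike.congr_fun hf x
    exact ⟨z, hz', by rwa [hf' z, ← hf' x₀], hrz⟩
  · have hr1 : r < 1 + ‖y‖ := by
      linarith [norm_sub_le y (G z), hG ▸ G.unit_le_opNorm z hz']
    have hu : u < ‖f.comp G‖ :=
      hua.trans_le ((le_abs_self _).trans ((f.comp G).unit_le_opNorm x₀ hx₀'))
    obtain ⟨x, hx, hfx, hGx⟩ := hDC.exists_mem_slice hG hf y
      (lt_min (sub_pos.2 hu) (sub_pos.2 hr1))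
    refine ⟨x, hx, ?_, ?_⟩
    · rw [ContinuousLinearMap.comp_apply] at hfx
      linarith [min_le_left (‖f.comp G‖ - u) (1 + ‖y‖ - r)]
    · linarith [min_le_right (‖f.comp G‖ - u) (1 + ‖y‖ - r)]
end

section
/- Let X and Y be real Banach spaces and let G : X → Y be a Daugavet center with ‖G‖ = 1. Then for every finite-dimensional linear subspace Y₀ of Y, every ε₀ > 0, and every x₀* in the unit sphere S_{X*} of X*, there exist x₁* ∈ S_{X*} and ε₁ > 0 such that the slice S(x₁*, ε₁) is contained in the slice S(x₀*, ε₀) and ‖y + t·Gx‖ ≥ (1 − ε₀)(‖y‖ + |t|) for all y ∈ Y₀, all x ∈ S(x₁*, ε₁), and all t ∈ ℝ. -/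
/-- The slice `S(x*, ε) = {x ∈ B_X : x*(x) ≥ 1 - ε}` of the closed unit ball. -/
def ballSlice {X : Type*} [NormedAddCommGroup X] [NormedSpace ℝ X]
    (x' : X →L[ℝ] ℝ) (ε : ℝ) : Set X :=
  {x : X | ‖x‖ ≤ 1 ∧ x' x ≥ 1 - ε}

section

variable {X Y : Type*} [NormedAddCommGroup X] [NormedSpace ℝ X]
    [NormedAddCommGroup Y] [NormedSpace ℝ Y]

theorem ballSlice_mono (x' : X →L[ℝ] ℝ) {ε δ : ℝ} (h : ε ≤ δ) :
    ballSlice x' ε ⊆ ballSlice x' δ := fun _ hx => ⟨hx.1, by linarith [hx.2]⟩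

theorem IsDaugavetCenter.exists_ballSlice_subset {G : X →L[ℝ] Y} (hDC : IsDaugavetCenter G)
    (hG : ‖G‖ = 1) {y : Y} (hy : ‖y‖ = 1) {x₀ : X →L[ℝ] ℝ} (hx₀ : ‖x₀‖ = 1)
    {ε : ℝ} (hε : 0 < ε) :
    ∃ x₁ : X →L[ℝ] ℝ, ‖x₁‖ = 1 ∧ ∃ δ : ℝ, 0 < δ ∧ ballSlice x₁ δ ⊆ ballSlice x₀ ε ∧
      ∀ x ∈ ballSlice x₁ δ, 2 - ε ≤ ‖y + G x‖ := by
  obtain ⟨δ, hδ, hδε, hδ1⟩ : ∃ δ : ℝ, 0 < δ ∧ 3 * δ ≤ ε ∧ 3 * δ < 1 :=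
    ⟨min ε 1 / 4, by positivity, by linarith [min_le_left ε 1, lt_min hε one_pos],
      by linarith [min_le_right ε 1]⟩
  have hnorm : ‖G + x₀.smulRight y‖ = 2 := by
    rw [hDC, hG, ContinuousLinearMap.norm_smulRight_apply, hx₀, hy]; norm_num
  obtain ⟨z, hz, hGz⟩ := ContinuousLinearMap.exists_lt_apply_of_lt_opNorm
    (G + x₀.smulRight y) (show 2 - δ < _ by rw [hnorm]; linarith)
  obtain ⟨g, hg, hgz⟩ : ∃ g : Y →L[ℝ] ℝ, ‖g‖ ≤ 1 ∧ 2 - δ < |g ((G + x₀.smulRight y) z)| := by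
    obtain ⟨g, hg, hgz⟩ := exists_dual_vector'' ℝ ((G + x₀.smulRight y) z)
    refine ⟨g, hg, ?_⟩
    rw [hgz]
    exact hGz.trans_le (le_abs_self _)
  wlog hgy : 0 ≤ g y generalizing g
  · refine this (-g) (by rwa [norm_neg]) ?_ ?_
    · simpa only [neg_apply, abs_neg] using hgz
    · simpa using (not_le.1 hgy).le
  have hg_le (v : Y) : g v ≤ ‖v‖ := (le_abs_self _).trans <| by
    simpa using g.le_of_opNorm_le hg v
  set f : X →L[ℝ] ℝ := g ∘L (G + x₀.smulRight y) with hf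
  have hfn : 2 - δ < ‖f‖ := by
    refine hgz.trans_le ?_
    exact (f.le_opNorm_of_le hz.le).trans_eq (mul_one _)
  have hf0 : 0 < ‖f‖ := by linarith
  have key {x : X} (hx : x ∈ ballSlice (‖f‖⁻¹ • f) δ) :
      x₀ x ≤ 1 ∧ g (G x) ≤ 1 ∧ 2 - 3 * δ ≤ g (G x) + x₀ x * g y := by
    obtain ⟨hx1, hx2⟩ := hx
    refine ⟨?_, ?_, ?_⟩
    · refine (le_abs_self _).trans ?_
      simpa [hx₀] using x₀.le_opNorm_of_le hx1
    · refine (hg_le _).trans ?_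
      simpa [hG] using G.le_opNorm_of_le hx1
    · have h : (1 - δ) * ‖f‖ ≤ f x := by
        have : 1 - δ ≤ f x / ‖f‖ := by simpa [div_eq_inv_mul] using hx2
        rwa [le_div_iff₀ hf0] at this
      have hfx : f x = g (G x) + x₀ x * g y := by simp [hf]
      rw [← hfx]
      nlinarith
  have hgy1 : g y ≤ 1 := hy ▸ hg_le y
  refine ⟨‖f‖⁻¹ • f, ?_, δ, hδ, fun x hx => ⟨hx.1, ?_⟩, fun x hx => ?_⟩
  · rw [norm_smul, norm_inv, norm_norm, inv_mul_cancel₀ hf0.ne']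
  · obtain ⟨-, h2, h3⟩ := key hx
    have h4 : 0 ≤ x₀ x := by
      by_contra! h
      nlinarith
    nlinarith
  · obtain ⟨h1, -, h3⟩ := key hx
    have h4 := hg_le (y + G x)
    rw [map_add] at h4
    nlinarith

theorem IsDaugavetCenter.exists_ballSlice_subset_finset {G : X →L[ℝ] Y}
    (hDC : IsDaugavetCenter G) (hG : ‖G‖ = 1) {x₀ : X →L[ℝ] ℝ} (hx₀ : ‖x₀‖ = 1)
    {ε : ℝ} (hε : 0 < ε) (F : Finset Y) (hF : ∀ y ∈ F, ‖y‖ = 1) :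
    ∃ x₁ : X →L[ℝ] ℝ, ‖x₁‖ = 1 ∧ ∃ δ : ℝ, 0 < δ ∧ ballSlice x₁ δ ⊆ ballSlice x₀ ε ∧
      ∀ y ∈ F, ∀ x ∈ ballSlice x₁ δ, 2 - ε ≤ ‖y + G x‖ := by
  classical
  induction F using Finset.induction_on with
  | empty => exact ⟨x₀, hx₀, ε, hε, subset_rfl, by simp⟩
  | insert a s _ ih =>
    obtain ⟨x₁, hx₁, δ, hδ, hsub, hs⟩ := ih fun y hy => hF y (Finset.mem_insert_of_mem hy)
    obtain ⟨x₂, hx₂, η, hη, hsub', ha⟩ := hDC.exists_ballSlice_subset hG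
      (hF a (Finset.mem_insert_self a s)) hx₁ (lt_min hδ hε)
    have hsub₂ := hsub'.trans (ballSlice_mono x₁ (min_le_left δ ε))
    refine ⟨x₂, hx₂, η, hη, hsub₂.trans hsub, fun y hy x hx => ?_⟩
    obtain rfl | hy := Finset.mem_insert.1 hy
    · linarith [ha x hx, min_le_right δ ε]
    · exact hs y hy x (hsub₂ hx)

theorem le_norm_smul_add_smul {u v : Y} (hu : ‖u‖ ≤ 1) (hv : ‖v‖ ≤ 1) {ε : ℝ} (hε : 0 ≤ ε)
    (h : 2 - ε ≤ ‖u + v‖) {a b : ℝ} (ha : 0 ≤ a) (hb : 0 ≤ b) :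
    (1 - ε) * (a + b) ≤ ‖a • u + b • v‖ := by
  wlog hab : b ≤ a generalizing a b u v
  · rw [add_comm a, add_comm (a • u)]
    exact this hv hu (by rwa [add_comm]) hb ha (le_of_not_ge hab)
  have h1 : a • (u + v) - (a - b) • v = a • u + b • v := by module
  have h2 := norm_sub_norm_le (a • (u + v)) ((a - b) • v)
  rw [h1, norm_smul, norm_smul, Real.norm_of_nonneg ha,
    Real.norm_of_nonneg (sub_nonneg.2 hab)] at h2
  nlinarith [mul_nonneg (sub_nonneg.2 hab) (sub_nonneg.2 hv),
    mul_nonneg ha (sub_nonneg.2 h), mul_nonneg hε hb]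

theorem Submodule.exists_finset_net_unit_sphere (S : Submodule ℝ Y) [FiniteDimensional ℝ S]
    {δ : ℝ} (hδ : 0 < δ) :
    ∃ F : Finset Y, (∀ y ∈ F, ‖y‖ = 1) ∧ ∀ y ∈ S, ‖y‖ = 1 → ∃ z ∈ F, ‖y - z‖ < δ := by
  classical
  obtain ⟨t, ht, htf, hcov⟩ :=
    (isCompact_sphere (0 : S) 1).finite_cover_balls hδ
  refine ⟨htf.toFinset.image (↑), ?_, fun y hy hy1 => ?_⟩
  · simp only [Finset.mem_image, Set.Finite.mem_toFinset]
    rintro _ ⟨z, hz, rfl⟩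
    simpa using ht hz
  · have hmem : (⟨y, hy⟩ : S) ∈ Metric.sphere (0 : S) 1 := by simpa using hy1
    obtain ⟨z, hz, hyz⟩ := Set.mem_iUnion₂.1 (hcov hmem)
    refine ⟨z, Finset.mem_image_of_mem _ (htf.mem_toFinset.2 hz), ?_⟩
    rwa [Metric.mem_ball, dist_eq_norm] at hyz

end

theorem stmt9 {X Y : Type*} [NormedAddCommGroup X] [NormedSpace ℝ X] [CompleteSpace X]
    [NormedAddCommGroup Y] [NormedSpace ℝ Y] [CompleteSpace Y]
    (G : X →L[ℝ] Y) (hG : ‖G‖ = 1) (hDC : IsDaugavetCenter G)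
    (Y₀ : Submodule ℝ Y) (hY₀ : FiniteDimensional ℝ Y₀)
    (ε₀ : ℝ) (hε₀ : 0 < ε₀) (x₀' : X →L[ℝ] ℝ) (hx₀' : ‖x₀'‖ = 1) :
    ∃ x₁' : X →L[ℝ] ℝ, ‖x₁'‖ = 1 ∧ ∃ ε₁ : ℝ, 0 < ε₁ ∧
      ballSlice x₁' ε₁ ⊆ ballSlice x₀' ε₀ ∧
      ∀ y ∈ Y₀, ∀ x ∈ ballSlice x₁' ε₁, ∀ t : ℝ,
        ‖y + t • G x‖ ≥ (1 - ε₀) * (‖y‖ + |t|) := by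
  classical
  obtain ⟨F, hF, hnet⟩ := Y₀.exists_finset_net_unit_sphere (half_pos hε₀)
  obtain ⟨w, hw⟩ : ∃ w : Y, ‖w‖ = 1 := by
    have : Nontrivial Y := by
      by_contra h
      rw [not_nontrivial_iff_subsingleton] at h
      have : G = 0 := by ext x; exact Subsingleton.elim _ _
      simp [this] at hG
    exact exists_norm_eq Y zero_le_one
  obtain ⟨x₁, hx₁, δ, hδ, hsub, hx⟩ := hDC.exists_ballSlice_subset_finset hG hx₀' (half_pos hε₀)
    (insert w F) (by simpa [hw] using hF)
  refine ⟨x₁, hx₁, δ, hδ, hsub.trans (ballSlice_mono _ (half_le_self hε₀.le)),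
    fun y hy x hxs t => ?_⟩
  have hGx : ‖G x‖ ≤ 1 := by simpa [hG] using G.le_opNorm_of_le hxs.1
  have hunit (u : Y) (hu : u ∈ Y₀) (hu1 : ‖u‖ = 1) : 2 - ε₀ ≤ ‖u + G x‖ := by
    obtain ⟨z, hz, huz⟩ := hnet u hu hu1
    have h1 := hx z (Finset.mem_insert_of_mem hz) x hxs
    have h2 := norm_sub_norm_le (z + G x) (u + G x)
    rw [add_sub_add_right_eq_sub, norm_sub_rev] at h2
    linarith
  obtain rfl | hy0 := eq_or_ne y 0
  · have h1 := hx w (Finset.mem_insert_self w F) x hxs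
    have h2 := norm_add_le w (G x)
    rw [zero_add, norm_smul, norm_zero, zero_add, Real.norm_eq_abs]
    nlinarith [abs_nonneg t]
  wlog ht : 0 ≤ t generalizing y t
  · have h := this (-y) (Y₀.neg_mem hy) (-t) (neg_ne_zero.2 hy0) (by linarith)
    rwa [neg_smul, ← neg_add, norm_neg, norm_neg, abs_neg] at h
  have hn : 0 < ‖y‖ := norm_pos_iff.2 hy0
  have hu1 : ‖‖y‖⁻¹ • y‖ = 1 := by
    rw [norm_smul, norm_inv, norm_norm, inv_mul_cancel₀ hn.ne']
  have h := le_norm_smul_add_smul hu1.le hGx hε₀.le (hunit _ (Y₀.smul_mem _ hy) hu1) hn.le ht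
  rw [smul_inv_smul₀ hn.ne'] at h
  rwa [abs_of_nonneg ht]
end
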